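/- Assume every ξ_r is a positive real number (zero imaginary part, positive real part). Then for every real x > 1/2, the values ξ(x+1/2), ξ_+(x), ξ_-(x) are real and satisfy ξ(x+1/2) > ξ_+(x) > ξ_-(x) > 0. -/

import Mathlib

open Complex

/-- The Riemann xi function: `ξ(s) = (s(s-1)/2)·Λ₀(s) + 1/2`. -/
noncomputable def xi (s : ℂ) : ℂ := s * (s - 1) / 2 * completedRiemannZeta₀ s + 1 / 2

/-- `ξ_r = ξ^{(2r)}(1/2) / (2r)!`. -/
noncomputable def xiCoeff (r : ℕ) : ℂ := iteratedDeriv (2 * r) xi (1 / 2) / ((2 * r).factorial : ℂ)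

/-- `ξ₊(s) = (1/2)(ξ(s+1/2) + ξ(s−1/2))`. -/
noncomputable def xiPlus (s : ℂ) : ℂ := (1 / 2) * (xi (s + 1 / 2) + xi (s - 1 / 2))

/-- `ξ₋(s) = (1/2)(ξ(s+1/2) − ξ(s−1/2))`. -/
noncomputable def xiMinus (s : ℂ) : ℂ := (1 / 2) * (xi (s + 1 / 2) - xi (s - 1 / 2))

theorem differentiable_xi : Differentiable ℂ xi := by
  unfold xi
  have := differentiable_completedZeta₀
  fun_prop

theorem xi_one_sub (s : ℂ) : xi (1 - s) = xi s := by
  simp only [xi, completedRiemannZeta₀_one_sub]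
  ring

theorem iteratedDeriv_xi_half_of_odd {n : ℕ} (hn : Odd n) : iteratedDeriv n xi (1 / 2) = 0 := by
  have h := congrFun (iteratedDeriv_comp_const_sub n xi 1) (1 / 2)
  simp only [xi_one_sub, hn.neg_one_pow] at h
  norm_num at h ⊢
  exact self_eq_neg.mp h

/-- Expansion of `xi` at the centre of its functional equation. -/
theorem hasSum_xi (z : ℂ) : HasSum (fun r : ℕ => xiCoeff r * z ^ (2 * r)) (xi (1 / 2 + z)) := by
  have h := Complex.hasSum_taylorSeries_of_entire differentiable_xi (1 / 2) (1 / 2 + z)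
  rw [← (mul_right_injective₀ (two_ne_zero (α := ℕ))).hasSum_iff] at h
  · refine h.congr_fun fun r => ?_
    simp [xiCoeff]
    ring
  · intro n hn
    have hodd : Odd n := by
      rw [← Nat.not_even_iff_odd]
      rintro ⟨k, rfl⟩
      exact hn ⟨k, by simp; ring⟩
    rw [iteratedDeriv_xi_half_of_odd hodd, smul_zero, smul_zero]

theorem xiCoeff_mul_ofReal_pow
    (h : ∀ r : ℕ, (xiCoeff r).im = 0 ∧ 0 < (xiCoeff r).re)
    (r : ℕ) (t : ℝ) :
    xiCoeff r * (t : ℂ) ^ (2 * r) = (((xiCoeff r).re * t ^ (2 * r) : ℝ) : ℂ) := by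
  apply Complex.ext <;> simp [← ofReal_pow, (h r).1]

theorem xi_half_add_ofReal_im
    (h : ∀ r : ℕ, (xiCoeff r).im = 0 ∧ 0 < (xiCoeff r).re) (t : ℝ) :
    (xi (1 / 2 + t)).im = 0 := by
  have hs := Complex.hasSum_im (hasSum_xi t)
  simp only [xiCoeff_mul_ofReal_pow h, ofReal_im] at hs
  exact hs.unique hasSum_zero

theorem hasSum_xi_half_add_ofReal_re
    (h : ∀ r : ℕ, (xiCoeff r).im = 0 ∧ 0 < (xiCoeff r).re)
    (t : ℝ) :
    HasSum (fun r : ℕ => (xiCoeff r).re * t ^ (2 * r)) (xi (1 / 2 + t)).re := by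
  have hs := Complex.hasSum_re (hasSum_xi t)
  simpa only [xiCoeff_mul_ofReal_pow h, ofReal_re] using hs

theorem xi_half_add_ofReal_re_pos
    (h : ∀ r : ℕ, (xiCoeff r).im = 0 ∧ 0 < (xiCoeff r).re) (t : ℝ) :
    0 < (xi (1 / 2 + t)).re := by
  refine hasSum_lt (i := 0) (fun r => ?_) ?_ hasSum_zero (hasSum_xi_half_add_ofReal_re h t)
  · exact mul_nonneg (h r).2.le ((even_two_mul r).pow_nonneg t)
  · simpa using (h 0).2

theorem xi_half_add_ofReal_re_lt
    (h : ∀ r : ℕ, (xiCoeff r).im = 0 ∧ 0 < (xiCoeff r).re)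
    {s t : ℝ} (hst : |s| < |t|) :
    (xi (1 / 2 + s)).re < (xi (1 / 2 + t)).re := by
  have hsq := sq_lt_sq.mpr hst
  refine hasSum_lt (i := 1) (fun r => ?_) ?_ (hasSum_xi_half_add_ofReal_re h s)
    (hasSum_xi_half_add_ofReal_re h t)
  · simp only [pow_mul]
    have := (h r).2
    gcongr
  · simpa using mul_lt_mul_of_pos_left hsq (h 1).2

/-- Inequality (30): if all `ξ_r` are positive reals, then for real `x > 1/2` the
values `ξ(x+1/2)`, `ξ₊(x)`, `ξ₋(x)` are real and `ξ(x+1/2) > ξ₊(x) > ξ₋(x) > 0`. -/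
theorem xi_inequalities_of_xiCoeff_pos
    (h : ∀ r : ℕ, (xiCoeff r).im = 0 ∧ 0 < (xiCoeff r).re)
    (x : ℝ) (hx : 1 / 2 < x) :
    (xi ((x : ℂ) + 1 / 2)).im = 0 ∧ (xiPlus (x : ℂ)).im = 0 ∧ (xiMinus (x : ℂ)).im = 0 ∧
    (xiPlus (x : ℂ)).re < (xi ((x : ℂ) + 1 / 2)).re ∧
    (xiMinus (x : ℂ)).re < (xiPlus (x : ℂ)).re ∧
    0 < (xiMinus (x : ℂ)).re := by
  have hplus : (x : ℂ) + 1 / 2 = 1 / 2 + (x : ℂ) := add_comm _ _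
  have hminus : (x : ℂ) - 1 / 2 = 1 / 2 + ((x - 1 : ℝ) : ℂ) := by
    push_cast
    ring
  have hlt : (xi (1 / 2 + ((x - 1 : ℝ) : ℂ))).re < (xi (1 / 2 + (x : ℂ))).re := by
    refine xi_half_add_ofReal_re_lt h (lt_of_lt_of_le ?_ (le_abs_self x))
    rw [abs_lt]
    constructor <;> linarith
  have hpos := xi_half_add_ofReal_re_pos h (x - 1)
  have him := xi_half_add_ofReal_im h x
  have him' := xi_half_add_ofReal_im h (x - 1)
  have hre : ∀ z : ℂ, (1 / 2 * z).re = z.re / 2 := fun z => by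
    rw [one_div_mul_eq_div, div_ofNat_re]
  have himag : ∀ z : ℂ, (1 / 2 * z).im = z.im / 2 := fun z => by
    rw [one_div_mul_eq_div, div_ofNat_im]
  simp only [xiPlus, xiMinus, hplus, hminus, hre, himag, add_re, sub_re, add_im, sub_im, him, him']
  refine ⟨trivial, by norm_num, by norm_num, ?_, ?_, ?_⟩ <;> linarith
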